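/- arXiv:2109.09024 — 2 statements merged into one kernel-verified Lean document; each statement's English description precedes it below -/
import Mathlib

section
/- Let p > 1 and a > 1, let f(v) = |v|^{p-1} v / (log(2 + v^2))^a, and let F(u) = ∫₀^u f(v) dv. Then there exist C > 0 and θ₀ > 0 such that for all θ ≥ θ₀: |F(θ) - θ^{p+1} / ((p+1) · (log(2 + θ²))^a)| ≤ C · θ^{p+1} / (log(2 + θ²))^{a+1}. -/
open Filter Set

/-- The strong perturbation `f(v) = |v|^{p-1} v / (log(2+v^2))^a`. -/
noncomputable def f (p a v : ℝ) : ℝ := |v| ^ (p - 1) * v / Real.log (2 + v ^ 2) ^ a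

/-- Its antiderivative `F(u) = ∫₀^u f(v) dv`. -/
noncomputable def Fint (p a u : ℝ) : ℝ := ∫ v in (0:ℝ)..u, f p a v

/-- `log (2 + v²)` is positive. -/
lemma log_two_add_sq_pos (v : ℝ) : 0 < Real.log (2 + v ^ 2) :=
  Real.log_pos (by nlinarith [sq_nonneg v])

lemma continuous_f {p : ℝ} (hp : 1 < p) (a : ℝ) : Continuous (f p a) := by
  unfold f
  refine Continuous.div ?_ ?_ fun v => (Real.rpow_pos_of_pos (log_two_add_sq_pos v) a).ne'
  · exact (continuous_abs.rpow_const fun _ => Or.inr (by linarith)).mul continuous_id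
  · refine Continuous.rpow_const ?_ fun v => Or.inl (log_two_add_sq_pos v).ne'
    exact Continuous.log (by fun_prop) fun v => by positivity

lemma f_of_pos (p a : ℝ) {v : ℝ} (hv : 0 < v) :
    f p a v = v ^ p / Real.log (2 + v ^ 2) ^ a := by
  rw [f, abs_of_pos hv, Real.rpow_sub_one hv.ne', div_mul_cancel₀ _ hv.ne']

lemma hasDerivAt_Fint {p : ℝ} (hp : 1 < p) (a v : ℝ) :
    HasDerivAt (Fint p a) (f p a v) v :=
  ((continuous_f hp a).integral_hasStrictDerivAt 0 v).hasDerivAt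

lemma hasDerivAt_rpow_div_log_rpow (p b : ℝ) {v : ℝ} (hv : 0 < v) :
    HasDerivAt (fun x : ℝ => x ^ (p + 1) / Real.log (2 + x ^ 2) ^ b)
      (v ^ p / Real.log (2 + v ^ 2) ^ b *
        ((p + 1) - 2 * b * (v ^ 2 / (2 + v ^ 2)) / Real.log (2 + v ^ 2))) v := by
  have hL := log_two_add_sq_pos v
  have h2 : (2 + v ^ 2 : ℝ) ≠ 0 := by positivity
  have hlog : HasDerivAt (fun x : ℝ => Real.log (2 + x ^ 2)) (2 * v / (2 + v ^ 2)) v := by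
    simpa using ((hasDerivAt_pow 2 v).const_add 2).log h2
  have hLb := Real.rpow_pos_of_pos hL b
  refine ((Real.hasDerivAt_rpow_const (p := p + 1) (Or.inl hv.ne')).fun_div
    (hlog.rpow_const (p := b) (Or.inl hL.ne')) hLb.ne').congr_deriv ?_
  rw [Real.rpow_sub_one hL.ne', add_sub_cancel_right, Real.rpow_add_one hv.ne']
  field_simp

/-- asymptotics of `F`:
`F(θ) = θ^{p+1}/((p+1) log^a(2+θ²)) + O(θ^{p+1}/log^{a+1}(2+θ²))` as `θ → +∞`. -/
theorem stmt_7 (p a : ℝ) (hp : 1 < p) (ha : 1 < a) :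
    ∃ C : ℝ, 0 < C ∧ ∃ θ₀ : ℝ, 0 < θ₀ ∧ ∀ θ : ℝ, θ₀ ≤ θ →
      |Fint p a θ - θ ^ (p + 1) / ((p + 1) * Real.log (2 + θ ^ 2) ^ a)| ≤
        C * θ ^ (p + 1) / Real.log (2 + θ ^ 2) ^ (a + 1) := by
  set G : ℝ → ℝ := fun x => x ^ (p + 1) / Real.log (2 + x ^ 2) ^ a with hG
  set H : ℝ → ℝ := fun x => x ^ (p + 1) / Real.log (2 + x ^ 2) ^ (a + 1) with hH
  set D : ℝ → ℝ := fun x => Fint p a x - G x / (p + 1) with hD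
  set w : ℝ → ℝ := fun x => x ^ p / Real.log (2 + x ^ 2) ^ (a + 1) with hw
  set s : ℝ → ℝ := fun x => x ^ 2 / (2 + x ^ 2) with hs
  have hs0 (x : ℝ) : 0 ≤ s x := by positivity
  have hs1 (x : ℝ) : s x ≤ 1 := by
    rw [hs, div_le_one (by positivity)]
    linarith
  have hw0 {x : ℝ} (hx : 0 < x) : 0 < w x :=
    div_pos (Real.rpow_pos_of_pos hx _) (Real.rpow_pos_of_pos (log_two_add_sq_pos x) _)
  have hderivD {x : ℝ} (hx : 0 < x) : HasDerivAt D (w x * (2 * a * s x / (p + 1))) x := by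
    have hL := log_two_add_sq_pos x
    have hLa := Real.rpow_pos_of_pos hL a
    have hp1 : p + 1 ≠ 0 := by linarith
    refine ((hasDerivAt_Fint hp a x).fun_sub
      ((hasDerivAt_rpow_div_log_rpow p a hx).div_const (p + 1))).congr_deriv ?_
    rw [f_of_pos p a hx]
    simp only [hw, hs]
    rw [Real.rpow_add_one hL.ne']
    field_simp
    ring
  set θ₀ : ℝ := Real.exp (2 * (a + 1) / p) with hθ₀
  have hθ₀pos : 0 < θ₀ := Real.exp_pos _
  have hderivH {x : ℝ} (hx : θ₀ ≤ x) : ∃ d, HasDerivAt H d x ∧ w x ≤ d := by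
    have hx0 := hθ₀pos.trans_le hx
    refine ⟨_, hasDerivAt_rpow_div_log_rpow p (a + 1) hx0, le_mul_of_one_le_right (hw0 hx0).le ?_⟩
    have hL := log_two_add_sq_pos x
    have hx1 : 1 ≤ θ₀ := Real.one_le_exp (by positivity)
    have hlog : 2 * (a + 1) / p ≤ Real.log (2 + x ^ 2) := by
      rw [Real.le_log_iff_exp_le (by positivity)]
      nlinarith
    rw [div_le_iff₀ (by linarith)] at hlog
    have : 2 * (a + 1) * s x / Real.log (2 + x ^ 2) ≤ p := by
      rw [div_le_iff₀ hL]
      nlinarith [hs1 x]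
    linarith
  have hHpos : 0 < H θ₀ :=
    div_pos (Real.rpow_pos_of_pos hθ₀pos _) (Real.rpow_pos_of_pos (log_two_add_sq_pos θ₀) _)
  set C : ℝ := 2 * a + |D θ₀| / H θ₀ with hC
  have hC2a : 2 * a ≤ C := le_add_of_nonneg_right (by positivity)
  have hCH : |D θ₀| ≤ C * H θ₀ := by
    rw [hC, add_mul, div_mul_cancel₀ _ hHpos.ne']
    exact le_add_of_nonneg_left (by positivity)
  have hmono (σ : ℝ) (hσ : |σ| = 1) : MonotoneOn (fun x => C * H x - σ * D x) (Ici θ₀) := by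
    have hder {x : ℝ} (hx : θ₀ ≤ x) :
        ∃ d, HasDerivAt (fun x => C * H x - σ * D x) d x ∧ 0 ≤ d := by
      have hx0 := hθ₀pos.trans_le hx
      obtain ⟨d, hd, hwd⟩ := hderivH hx
      refine ⟨_, (hd.const_mul C).fun_sub ((hderivD hx0).const_mul σ), ?_⟩
      have hr0 : 0 ≤ 2 * a * s x / (p + 1) := by have := hs0 x; positivity
      have hr1 : 2 * a * s x / (p + 1) ≤ 2 * a := by
        rw [div_le_iff₀ (by linarith)]
        nlinarith [hs1 x]
      have hwx := hw0 hx0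
      have hDle : w x * (2 * a * s x / (p + 1)) ≤ C * d := by
        rw [mul_comm C]
        exact mul_le_mul hwd (hr1.trans hC2a) hr0 (hwx.le.trans hwd)
      have hσ1 := (abs_le.mp hσ.le).2
      have := mul_le_of_le_one_left (mul_nonneg hwx.le hr0) hσ1
      linarith
    refine monotoneOn_of_deriv_nonneg (convex_Ici θ₀) ?_ ?_ ?_
    · intro x hx
      obtain ⟨d, hd, -⟩ := hder hx
      exact hd.continuousAt.continuousWithinAt
    · intro x hx
      obtain ⟨d, hd, -⟩ := hder (interior_subset hx)
      exact hd.differentiableAt.differentiableWithinAt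
    · intro x hx
      obtain ⟨d, hd, h0⟩ := hder (interior_subset hx)
      rwa [hd.deriv]
  refine ⟨C, by linarith, θ₀, hθ₀pos, fun θ hθ => ?_⟩
  have key : |D θ| ≤ C * H θ := by
    have h₁ := hmono 1 (by simp) self_mem_Ici hθ hθ
    have h₂ := hmono (-1) (by simp) self_mem_Ici hθ hθ
    have h₃ := abs_le.mp hCH
    simp only at h₁ h₂
    exact abs_le.mpr ⟨by linarith, by linarith⟩
  convert key using 1
  · simp only [hD, hG, div_div, mul_comm]
  · simp only [hH, mul_div_assoc]
end

section
/- Let p > 1 and a > 1, and let f(v) = |v|^{p-1} v / (log(2 + v^2))^a. For x ≥ 0, q ∈ ℝ and s ≥ 0 define f̂(x, q, s) = e^{-2ps/(p-1)} · ( f(e^{2s/(p-1)}(x + q)) - f(e^{2s/(p-1)} x) - e^{2s/(p-1)} q · f'(e^{2s/(p-1)} x) ), and F̂(x, q, s) = ∫₀^q f̂(x, q', s) dq'. Then there exists C > 0 such that for all s ≥ 0, all x ≥ 0 and all q ∈ ℝ: |F̂(x, q, s)| ≤ C (δ_{p≥2} · x^{p-2} |q|³ + |q|^{p+1}), where δ_{p≥2}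 equals 1 if p ≥ 2 and 0 if 1 < p < 2. -/
open Filter Set

/-- The quadratic remainder `f̂` of the linearization of the rescaled perturbation. -/
noncomputable def fhat (p a x q s : ℝ) : ℝ :=
  Real.exp (-2 * p * s / (p - 1)) *
    (f p a (Real.exp (2 * s / (p - 1)) * (x + q))
      - f p a (Real.exp (2 * s / (p - 1)) * x)
      - Real.exp (2 * s / (p - 1)) * q * deriv (f p a) (Real.exp (2 * s / (p - 1)) * x))

/-- Its antiderivative in `q`: `F̂(x,q,s) = ∫₀^q f̂(x,q',s) dq'`. -/
noncomputable def Fhat (p a x q s : ℝ) : ℝ := ∫ q' in (0:ℝ)..q, fhat p a x q' s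

theorem log_two_le_log_two_add_sq (v : ℝ) : Real.log 2 ≤ Real.log (2 + v ^ 2) :=
  Real.log_le_log (by norm_num) (by nlinarith [sq_nonneg v])

/-- The factor `H` in `f'(v) = |v|^{p-1} H(log(2+v²))`. -/
noncomputable def derivFactor (p a l : ℝ) : ℝ :=
  p * l ^ (-a) - 2 * a * (1 - 2 * Real.exp (-l)) * l ^ (-a - 1)

theorem hasDerivAt_log_two_add_sq (v : ℝ) :
    HasDerivAt (fun v : ℝ => Real.log (2 + v ^ 2)) (2 * v / (2 + v ^ 2)) v := by
  have h : HasDerivAt (fun v : ℝ => 2 + v ^ 2) (2 * v) v := by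
    simpa using (hasDerivAt_pow 2 v).const_add 2
  exact h.log (by positivity)

theorem hasDerivAt_abs_rpow_mul_self {r : ℝ} (hr : 0 < r) (v : ℝ) :
    HasDerivAt (fun v : ℝ => |v| ^ r * v) ((r + 1) * |v| ^ r) v := by
  rcases eq_or_ne v 0 with rfl | hv
  · rw [hasDerivAt_iff_tendsto_slope]
    have hc : Tendsto (fun v : ℝ => |v| ^ r) (nhdsWithin 0 {0}ᶜ) (nhds ((r + 1) * |0| ^ r)) := by
      have : ContinuousAt (fun v : ℝ => |v| ^ r) 0 :=
        continuous_abs.continuousAt.rpow_const (Or.inr hr.le)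
      have h := this.tendsto.mono_left (nhdsWithin_le_nhds (s := {0}ᶜ))
      simpa [Real.zero_rpow hr.ne'] using h
    refine hc.congr' ?_
    filter_upwards [self_mem_nhdsWithin] with y hy
    have hy : y ≠ 0 := hy
    simp [slope_def_field, hy]
  · have h := ((hasDerivAt_abs hv).rpow_const (p := r)
      (Or.inl (abs_ne_zero.2 hv))).mul (hasDerivAt_id v)
    refine h.congr_deriv ?_
    have h1 : |v| ^ r = |v| ^ (r - 1) * |v| := by
      rw [← Real.rpow_add_one (abs_ne_zero.2 hv)]; simp
    have h2 : (SignType.sign v : ℝ) * v = |v| := sign_mul_self v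
    simp only [id]
    rw [h1]
    linear_combination (r * |v| ^ (r - 1)) * h2

theorem hasDerivAt_f {p : ℝ} (a : ℝ) (hp : 1 < p) (v : ℝ) :
    HasDerivAt (f p a) (|v| ^ (p - 1) * derivFactor p a (Real.log (2 + v ^ 2))) v := by
  have hL : ∀ v : ℝ, 0 < Real.log (2 + v ^ 2) := fun v =>
    (Real.log_pos one_lt_two).trans_le (log_two_le_log_two_add_sq v)
  have hf : f p a = fun v => |v| ^ (p - 1) * v * Real.log (2 + v ^ 2) ^ (-a) := by
    funext v
    rw [f, Real.rpow_neg (hL v).le, div_eq_mul_inv]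
  rw [hf]
  have h := (hasDerivAt_abs_rpow_mul_self (sub_pos.2 hp) v).mul
    ((hasDerivAt_log_two_add_sq v).rpow_const (p := -a) (Or.inl (hL v).ne'))
  refine h.congr_deriv ?_
  have h2 : (2 : ℝ) + v ^ 2 ≠ 0 := by positivity
  rw [derivFactor, Real.exp_neg, Real.exp_log (by positivity)]
  field_simp
  ring

theorem exists_abs_derivFactor_le (p a : ℝ) (ha : 0 < a) :
    ∃ M, 0 ≤ M ∧ ∀ l, Real.log 2 ≤ l → |derivFactor p a l| ≤ M := by
  have h2 := Real.log_pos one_lt_two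
  have key : ∀ b : ℝ, b ≤ 0 → ∀ l, Real.log 2 ≤ l → |l ^ b| ≤ Real.log 2 ^ b := fun b hb l hl => by
    rw [abs_of_nonneg (Real.rpow_nonneg (h2.le.trans hl) _)]
    exact Real.rpow_le_rpow_of_nonpos h2 hl hb
  refine ⟨|p| * Real.log 2 ^ (-a) + 2 * a * 1 * Real.log 2 ^ (-a - 1), by positivity, ?_⟩
  intro l hl
  have he : |1 - 2 * Real.exp (-l)| ≤ 1 := by
    have : Real.exp (-l) ≤ 1 := Real.exp_le_one_iff.2 (by linarith)
    rw [abs_le]; constructor <;> linarith [Real.exp_pos (-l)]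
  have k1 := key (-a) (by linarith) l hl
  have k2 := key (-a - 1) (by linarith) l hl
  rw [derivFactor]
  refine (abs_sub _ _).trans ?_
  simp only [abs_mul, abs_two, abs_of_pos ha]
  gcongr

theorem exists_abs_derivFactor_sub_le (p a : ℝ) (ha : 0 < a) :
    ∃ K, 0 ≤ K ∧ ∀ l m, Real.log 2 ≤ l → Real.log 2 ≤ m →
      |derivFactor p a m - derivFactor p a l| ≤ K * |m - l| := by
  have h2 := Real.log_pos one_lt_two
  have key : ∀ b : ℝ, b ≤ 0 → ∀ l, Real.log 2 ≤ l → |l ^ b| ≤ Real.log 2 ^ b := fun b hb l hl => by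
    rw [abs_of_nonneg (Real.rpow_nonneg (h2.le.trans hl) _)]
    exact Real.rpow_le_rpow_of_nonpos h2 hl hb
  refine ⟨|p| * (a * Real.log 2 ^ (-a - 1)) + 2 * a * (2 * 1 * Real.log 2 ^ (-a - 1)
    + 1 * ((a + 1) * Real.log 2 ^ (-a - 1 - 1))), by positivity, ?_⟩
  intro l m hl hm
  have hd : ∀ t ∈ Ici (Real.log 2), HasDerivWithinAt (derivFactor p a)
      (p * (-a * t ^ (-a - 1)) - 2 * a * (2 * Real.exp (-t) * t ^ (-a - 1)
        + (1 - 2 * Real.exp (-t)) * ((-a - 1) * t ^ (-a - 1 - 1)))) (Ici (Real.log 2)) t := by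
    intro t ht
    have ht0 : t ≠ 0 := (h2.trans_le ht).ne'
    have d1 := Real.hasDerivAt_rpow_const (p := -a) (Or.inl ht0)
    have d2 := Real.hasDerivAt_rpow_const (p := -a - 1) (Or.inl ht0)
    have d3 := ((hasDerivAt_neg t).exp.const_mul 2).const_sub 1
    refine (((d1.const_mul p).sub ((d3.const_mul (2 * a)).mul d2)).congr_deriv ?_).hasDerivWithinAt
    ring
  refine (convex_Ici _).norm_image_sub_le_of_norm_hasDerivWithin_le hd ?_ hl hm
  intro t ht
  have ht : Real.log 2 ≤ t := ht
  have he1 : Real.exp (-t) ≤ 1 := Real.exp_le_one_iff.2 (by linarith)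
  have he : |1 - 2 * Real.exp (-t)| ≤ 1 := by
    rw [abs_le]; constructor <;> linarith [Real.exp_pos (-t)]
  have k2 := key (-a - 1) (by linarith) t ht
  have k3 := key (-a - 1 - 1) (by linarith) t ht
  rw [Real.norm_eq_abs]
  refine (abs_sub _ _).trans ?_
  rw [abs_mul (2 * a)]
  refine add_le_add ?_ ?_
  · simp only [abs_mul, abs_neg, abs_of_pos ha]
    gcongr
  · rw [abs_of_pos (by positivity : 0 < 2 * a)]
    refine mul_le_mul_of_nonneg_left ((abs_add_le _ _).trans ?_) (by positivity)
    have : |-a - 1| = a + 1 := by rw [abs_of_neg (by linarith)]; ring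
    simp only [abs_mul, abs_two, Real.abs_exp, this]
    gcongr

theorem mul_log_two_add_sq_sub_le {u v : ℝ} (hu : 0 ≤ u) (huv : u ≤ v) :
    u * |Real.log (2 + v ^ 2) - Real.log (2 + u ^ 2)| ≤ 2 * (v - u) := by
  rcases hu.eq_or_lt with rfl | hu0
  · simpa using huv
  have hv0 := hu0.trans_le huv
  have h0 : Real.log (2 + u ^ 2) ≤ Real.log (2 + v ^ 2) :=
    Real.log_le_log (by positivity) (by gcongr)
  have h1 : Real.log (2 + v ^ 2) - Real.log (2 + u ^ 2) ≤ 2 * (v / u - 1) := by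
    rw [← Real.log_div (by positivity) (by positivity)]
    calc _ ≤ Real.log ((v / u) ^ 2) := by
          refine Real.log_le_log (by positivity) ?_
          rw [div_pow, div_le_div_iff₀ (by positivity) (by positivity)]
          nlinarith
      _ = 2 * Real.log (v / u) := by rw [Real.log_pow]; norm_num
      _ ≤ _ := by gcongr; exact Real.log_le_sub_one_of_pos (by positivity)
  rw [abs_of_nonneg (sub_nonneg.2 h0)]
  calc _ ≤ u * (2 * (v / u - 1)) := by gcongr
    _ = _ := by field_simp

theorem rpow_sub_rpow_le_mul {r u v : ℝ} (hr : 1 ≤ r) (hu : 0 ≤ u) (huv : u ≤ v) :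
    v ^ r - u ^ r ≤ r * v ^ (r - 1) * (v - u) := by
  refine (le_abs_self _).trans ?_
  have h := (convex_Icc u v).norm_image_sub_le_of_norm_hasDerivWithin_le (f := fun t : ℝ => t ^ r)
    (C := r * v ^ (r - 1))
    (fun t _ => (Real.hasDerivAt_rpow_const (Or.inr hr)).hasDerivWithinAt) ?_
    (left_mem_Icc.2 huv) (right_mem_Icc.2 huv)
  · simpa [abs_of_nonneg (sub_nonneg.2 huv)] using h
  · rintro t ⟨h1, h2⟩
    have ht : 0 ≤ t := hu.trans h1
    rw [Real.norm_eq_abs, abs_of_nonneg (by positivity)]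
    gcongr

theorem rpow_sub_rpow_le_sub_rpow {r u v : ℝ} (h0 : 0 ≤ r) (h1 : r ≤ 1) (hu : 0 ≤ u)
    (huv : u ≤ v) : v ^ r - u ^ r ≤ (v - u) ^ r := by
  have := Real.rpow_add_le_add_rpow (sub_nonneg.2 huv) hu h0 h1
  rw [sub_add_cancel] at this
  linarith

/-- Modulus of continuity of `v ↦ v^r h(v)` when `h` is bounded with `|v h'(v)|` bounded. -/
theorem abs_rpow_mul_sub_le {r M K u v : ℝ} {h : ℝ → ℝ} (hr : 0 < r) (hM : ∀ t, |h t| ≤ M)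
    (hu : 0 ≤ u) (huv : u ≤ v) (hK : u * |h v - h u| ≤ K * (v - u)) (hK0 : 0 ≤ K) :
    |v ^ r * h v - u ^ r * h u| ≤
      if 1 ≤ r then (r * M + K) * (v ^ (r - 1) * (v - u)) else (3 * M + K) * (v - u) ^ r := by
  have hM0 : 0 ≤ M := (abs_nonneg _).trans (hM 0)
  have hmono : u ^ r ≤ v ^ r := Real.rpow_le_rpow hu huv hr.le
  have hsub : 0 ≤ v - u := sub_nonneg.2 huv
  have hsplit : |v ^ r * h v - u ^ r * h u| ≤ (v ^ r - u ^ r) * M + u ^ r * |h v - h u| := by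
    calc _ = |(v ^ r - u ^ r) * h v + u ^ r * (h v - h u)| := by congr 1; ring
      _ ≤ |(v ^ r - u ^ r) * h v| + |u ^ r * (h v - h u)| := abs_add_le _ _
      _ ≤ _ := by
        rw [abs_mul, abs_mul, abs_of_nonneg (sub_nonneg.2 hmono),
          abs_of_nonneg (Real.rpow_nonneg hu r)]
        have := sub_nonneg.2 hmono
        gcongr
        exact hM v
  refine hsplit.trans ?_
  rcases hu.eq_or_lt with rfl | hu0
  · rw [Real.zero_rpow hr.ne']
    split_ifs with h1
    · rcases huv.eq_or_lt with rfl | hv0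
      · simp [Real.zero_rpow hr.ne']
      have : v ^ (r - 1) * v = v ^ r := by rw [← Real.rpow_add_one hv0.ne']; simp
      rw [sub_zero, sub_zero, this, zero_mul, add_zero]
      nlinarith [mul_nonneg hM0 (Real.rpow_nonneg huv r), mul_nonneg hK0 (Real.rpow_nonneg huv r),
        mul_nonneg (sub_nonneg.2 h1) (mul_nonneg hM0 (Real.rpow_nonneg huv r))]
    · rw [sub_zero, sub_zero, zero_mul, add_zero]
      nlinarith [mul_nonneg hM0 (Real.rpow_nonneg huv r), mul_nonneg hK0 (Real.rpow_nonneg huv r)]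
  have hur : u ^ r = u ^ (r - 1) * u := by rw [← Real.rpow_add_one hu0.ne']; simp
  have hsecond : u ^ r * |h v - h u| ≤ K * (u ^ (r - 1) * (v - u)) := by
    calc _ = u ^ (r - 1) * (u * |h v - h u|) := by rw [hur]; ring
      _ ≤ u ^ (r - 1) * (K * (v - u)) := by gcongr
      _ = _ := by ring
  split_ifs with h1
  · have hfirst := mul_le_mul_of_nonneg_right (rpow_sub_rpow_le_mul h1 hu huv) hM0
    have : u ^ (r - 1) * (v - u) ≤ v ^ (r - 1) * (v - u) := by
      gcongr
    nlinarith [mul_le_mul_of_nonneg_left this hK0]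
  · push Not at h1
    have hfirst := mul_le_mul_of_nonneg_right (rpow_sub_rpow_le_sub_rpow hr.le h1.le hu huv) hM0
    have hpow : 0 ≤ (v - u) ^ r := Real.rpow_nonneg hsub r
    rcases le_total (v - u) u with hcase | hcase
    · have : u ^ (r - 1) * (v - u) ≤ (v - u) ^ r := by
        rcases hsub.eq_or_lt with h0 | h0
        · rw [← h0, Real.zero_rpow hr.ne', mul_zero]
        calc u ^ (r - 1) * (v - u) ≤ (v - u) ^ (r - 1) * (v - u) := by
              gcongr ?_ * _
              exact Real.rpow_le_rpow_of_nonpos h0 hcase (by linarith)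
          _ = _ := by rw [← Real.rpow_add_one h0.ne']; simp
      nlinarith [mul_le_mul_of_nonneg_left this hK0, mul_nonneg hM0 hpow]
    · have h3 : u ^ r ≤ (v - u) ^ r := Real.rpow_le_rpow hu hcase hr.le
      have h4 : |h v - h u| ≤ 2 * M := by
        linarith [abs_sub (h v) (h u), hM u, hM v]
      have h5 : u ^ r * |h v - h u| ≤ (v - u) ^ r * (2 * M) := by gcongr
      nlinarith [mul_nonneg hK0 hpow]

theorem rpow_add_le_two_rpow_mul {r x y : ℝ} (hr : 0 ≤ r) (hx : 0 ≤ x) (hy : 0 ≤ y) :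
    (x + y) ^ r ≤ 2 ^ r * (x ^ r + y ^ r) := by
  have hm : 0 ≤ max x y := le_max_of_le_left hx
  calc (x + y) ^ r ≤ (2 * max x y) ^ r :=
        Real.rpow_le_rpow (by positivity)
          (by linarith [le_max_left x y, le_max_right x y]) hr
    _ = 2 ^ r * max x y ^ r := Real.mul_rpow zero_le_two hm
    _ ≤ _ := by
      gcongr
      rcases max_cases x y with h | h <;> rw [h.1] <;>
        linarith [Real.rpow_nonneg hx r, Real.rpow_nonneg hy r]

theorem exists_abs_deriv_f_sub_le {p a : ℝ} (hp : 1 < p) (ha : 0 < a) :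
    ∃ C, 0 < C ∧ ∀ x, 0 ≤ x → ∀ q, |deriv (f p a) (x + q) - deriv (f p a) x| ≤
      C * ((if 2 ≤ p then (1:ℝ) else 0) * x ^ (p - 2) * |q| + |q| ^ (p - 1)) := by
  obtain ⟨M, hM0, hM⟩ := exists_abs_derivFactor_le p a ha
  obtain ⟨K, hK0, hK⟩ := exists_abs_derivFactor_sub_le p a ha
  set h : ℝ → ℝ := fun v => derivFactor p a (Real.log (2 + v ^ 2)) with hh
  have hderiv : ∀ v, deriv (f p a) v = |v| ^ (p - 1) * h |v| := fun v => by
    rw [(hasDerivAt_f a hp v).deriv, hh]; simp only [sq_abs]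
  have hcore : ∀ u v, 0 ≤ u → u ≤ v → |v ^ (p - 1) * h v - u ^ (p - 1) * h u| ≤
      if 1 ≤ p - 1 then ((p - 1) * M + K * 2) * (v ^ (p - 1 - 1) * (v - u))
      else (3 * M + K * 2) * (v - u) ^ (p - 1) := by
    intro u v hu huv
    refine abs_rpow_mul_sub_le (by linarith) (fun t => hM _ (log_two_le_log_two_add_sq t)) hu huv
      ?_ (by positivity)
    calc u * |h v - h u| ≤ u * (K * |Real.log (2 + v ^ 2) - Real.log (2 + u ^ 2)|) := by
          gcongr
          exact hK _ _ (log_two_le_log_two_add_sq u) (log_two_le_log_two_add_sq v)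
      _ = K * (u * |Real.log (2 + v ^ 2) - Real.log (2 + u ^ 2)|) := by ring
      _ ≤ K * (2 * (v - u)) := by exact mul_le_mul_of_nonneg_left (mul_log_two_add_sq_sub_le hu huv) hK0
      _ = _ := by ring
  by_cases h2 : 2 ≤ p
  · have h1 : 1 ≤ p - 1 := by linarith
    have hp1 : 0 ≤ p - 1 := by linarith
    have hpp : p - 1 - 1 = p - 2 := by ring
    simp only [h1, if_true, hpp] at hcore
    refine ⟨((p - 1) * M + K * 2) * 2 ^ (p - 2) + 1, by positivity, fun x hx q => ?_⟩
    have hq := abs_nonneg q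
    have hbound : |deriv (f p a) (x + q) - deriv (f p a) x| ≤
        ((p - 1) * M + K * 2) * ((x + |q|) ^ (p - 2) * |q|) := by
      rw [hderiv, hderiv, abs_of_nonneg hx]
      have hy1 : |x + q| ≤ x + |q| := (abs_add_le _ _).trans (by rw [abs_of_nonneg hx])
      have hy2 : x - |x + q| ≤ |q| := by
        have := abs_sub_abs_le_abs_sub x (x + q)
        rw [abs_of_nonneg hx] at this
        simpa using this
      rcases le_total x |x + q| with hxy | hxy
      · refine (hcore _ _ hx hxy).trans ?_
        have : 0 ≤ |x + q| - x := sub_nonneg.2 hxy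
        gcongr
        linarith
      · rw [abs_sub_comm]
        refine (hcore _ _ (abs_nonneg _) hxy).trans ?_
        have : 0 ≤ x - |x + q| := sub_nonneg.2 hxy
        gcongr
        linarith
    refine hbound.trans ?_
    have hqq : |q| ^ (p - 2) * |q| = |q| ^ (p - 1) := by
      rw [← Real.rpow_add_one' hq (by linarith)]
      congr 1; ring
    have hxp := Real.rpow_nonneg hx (p - 2)
    have hqp := Real.rpow_nonneg hq (p - 1)
    rw [if_pos h2, one_mul, ← hqq]
    calc _ ≤ ((p - 1) * M + K * 2) * (2 ^ (p - 2) * (x ^ (p - 2) + |q| ^ (p - 2)) * |q|) := by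
          gcongr
          exact rpow_add_le_two_rpow_mul (by linarith) hx hq
      _ = (((p - 1) * M + K * 2) * 2 ^ (p - 2)) *
          (x ^ (p - 2) * |q| + |q| ^ (p - 2) * |q|) := by ring
      _ ≤ _ := by
        gcongr
        linarith
  · have h1 : ¬ 1 ≤ p - 1 := by linarith
    have hp1 : 0 ≤ p - 1 := by linarith
    simp only [h1, if_false] at hcore
    refine ⟨3 * M + K * 2 + 1, by positivity, fun x hx q => ?_⟩
    rw [if_neg h2, zero_mul, zero_mul, zero_add, hderiv, hderiv, abs_of_nonneg hx]
    have hqp := Real.rpow_nonneg (abs_nonneg q) (p - 1)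
    have hy : |(|x + q| - x)| ≤ |q| := by
      have := abs_abs_sub_abs_le_abs_sub (x + q) x
      rw [abs_of_nonneg hx] at this
      simpa using this
    obtain ⟨hy1, hy2⟩ := abs_le.1 hy
    refine le_trans ?_ (mul_le_mul_of_nonneg_right (by linarith : 3 * M + K * 2 ≤ _) hqp)
    rcases le_total x |x + q| with hxy | hxy
    · refine (hcore _ _ hx hxy).trans ?_
      have : 0 ≤ |x + q| - x := sub_nonneg.2 hxy
      gcongr
    · rw [abs_sub_comm]
      refine (hcore _ _ (abs_nonneg _) hxy).trans ?_
      have : 0 ≤ x - |x + q| := sub_nonneg.2 hxy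
      gcongr
      linarith

theorem exists_abs_taylor_remainder_le {p a : ℝ} (hp : 1 < p) (ha : 0 < a) :
    ∃ C, 0 < C ∧ ∀ x, 0 ≤ x → ∀ q, |f p a (x + q) - f p a x - q * deriv (f p a) x| ≤
      C * ((if 2 ≤ p then (1:ℝ) else 0) * x ^ (p - 2) * |q| ^ 2 + |q| ^ p) := by
  obtain ⟨C, hC, h⟩ := exists_abs_deriv_f_sub_le hp ha
  refine ⟨C, hC, fun x hx q => ?_⟩
  set D : ℝ := if 2 ≤ p then 1 else 0 with hD
  have hD0 : 0 ≤ D := by rw [hD]; split_ifs <;> norm_num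
  have hp1 : 0 ≤ p - 1 := by linarith
  have hxp := Real.rpow_nonneg hx (p - 2)
  have hd : ∀ t ∈ uIcc 0 q, HasDerivWithinAt
      (fun t => f p a (x + t) - t * deriv (f p a) x)
      (deriv (f p a) (x + t) - deriv (f p a) x) (uIcc 0 q) t := by
    intro t _
    have h1 := (hasDerivAt_f a hp (x + t)).differentiableAt.hasDerivAt.comp_const_add x t
    have h2 := (hasDerivAt_id t).mul_const (deriv (f p a) x)
    exact (h1.sub h2).hasDerivWithinAt.congr_deriv (by ring)
  have hb := (convex_uIcc (0:ℝ) q).norm_image_sub_le_of_norm_hasDerivWithin_le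
    (C := C * (D * x ^ (p - 2) * |q| + |q| ^ (p - 1))) hd ?_ left_mem_uIcc right_mem_uIcc
  · have e : |q| ^ (p - 1) * |q| = |q| ^ p := by
      rw [← Real.rpow_add_one' (abs_nonneg q) (by linarith)]
      congr 1; ring
    rw [← e]
    simp only [add_zero, zero_mul, sub_zero, Real.norm_eq_abs] at hb
    rw [sub_right_comm]
    refine hb.trans (le_of_eq ?_)
    ring
  · intro t ht
    refine (h x hx t).trans ?_
    have : |t| ≤ |q| := by simpa using abs_sub_left_of_mem_uIcc ht
    gcongr

theorem abs_fhat_le {p a C x q : ℝ} (s : ℝ)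
    (h : ∀ x, 0 ≤ x → ∀ q, |f p a (x + q) - f p a x - q * deriv (f p a) x| ≤
      C * ((if 2 ≤ p then (1:ℝ) else 0) * x ^ (p - 2) * |q| ^ 2 + |q| ^ p)) (hx : 0 ≤ x) :
    |fhat p a x q s| ≤
      C * ((if 2 ≤ p then (1:ℝ) else 0) * x ^ (p - 2) * |q| ^ 2 + |q| ^ p) := by
  set D : ℝ := if 2 ≤ p then 1 else 0
  rw [fhat]
  set l := Real.exp (2 * s / (p - 1)) with hl
  have hl0 : 0 < l := Real.exp_pos _
  have hlp : Real.exp (-2 * p * s / (p - 1)) * l ^ p = 1 := by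
    rw [hl, ← Real.exp_mul, ← Real.exp_add, ← Real.exp_zero]
    congr 1; ring
  rw [abs_mul, Real.abs_exp, mul_add l x q]
  calc _ ≤ Real.exp (-2 * p * s / (p - 1)) *
        (C * (D * (l * x) ^ (p - 2) * |l * q| ^ 2 + |l * q| ^ p)) := by
        gcongr
        exact h (l * x) (by positivity) (l * q)
    _ = Real.exp (-2 * p * s / (p - 1)) * l ^ p *
        (C * (D * x ^ (p - 2) * |q| ^ 2 + |q| ^ p)) := by
        have e : l ^ (p - 2) * l ^ 2 = l ^ p := by
          rw [← Real.rpow_add_natCast hl0.ne']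
          congr 1; push_cast; ring
        rw [abs_mul, abs_of_pos hl0, Real.mul_rpow hl0.le hx, Real.mul_rpow hl0.le (abs_nonneg q),
          ← e]
        ring
    _ = _ := by rw [hlp, one_mul]

/-- `|F̂(x,q,s)| ≤ C (δ_{p≥2} x^{p-2} |q|³ + |q|^{p+1})`, uniformly in `s ≥ 0`. -/
theorem stmt_11 (p a : ℝ) (hp : 1 < p) (ha : 1 < a) :
    ∃ C : ℝ, 0 < C ∧ ∀ s : ℝ, 0 ≤ s → ∀ x : ℝ, 0 ≤ x → ∀ q : ℝ,
      |Fhat p a x q s| ≤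
        C * ((if 2 ≤ p then (1:ℝ) else 0) * x ^ (p - 2) * |q| ^ 3 + |q| ^ (p + 1)) := by
  obtain ⟨C, hC, h⟩ := exists_abs_taylor_remainder_le hp (zero_lt_one.trans ha)
  refine ⟨C, hC, fun s _ x hx q => ?_⟩
  have hb := fun t => abs_fhat_le (q := t) s h hx
  set D : ℝ := if 2 ≤ p then 1 else 0 with hD
  have hD0 : 0 ≤ D := by rw [hD]; split_ifs <;> norm_num
  have hp0 : 0 ≤ p := by linarith
  have hxp := Real.rpow_nonneg hx (p - 2)
  have hi := intervalIntegral.norm_integral_le_of_norm_le_const (a := 0) (b := q)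
    (f := fun t => fhat p a x t s) (C := C * (D * x ^ (p - 2) * |q| ^ 2 + |q| ^ p)) ?_
  · rw [Real.norm_eq_abs, sub_zero] at hi
    rw [Fhat, Real.rpow_add_one' (abs_nonneg q) (by linarith)]
    refine hi.trans (le_of_eq ?_)
    ring
  · intro t ht
    refine (hb t).trans ?_
    have : |t| ≤ |q| := by simpa using abs_sub_left_of_mem_uIcc (uIoc_subset_uIcc ht)
    gcongr
end
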